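/- (QT-SVD) Let A ∈ ℍ^{n₁×n₂×n₃} be a third-order quaternion tensor. Then there exist unitary quaternion tensors U ∈ ℍ^{n₁×n₁×n₃} and V ∈ ℍ^{n₂×n₂×n₃} and an f-diagonal quaternion tensor S ∈ ℍ^{n₁×n₂×n₃} such that A = U *_Q S *_Q V*. -/

import Mathlib

open Matrix Kronecker

noncomputable section

/-- The real quaternions. -/
abbrev Quat := Quaternion ℝ

/-- The embedding of `ℂ` into the quaternions (via `1` and `i`). -/
def c2q (z : ℂ) : Quat := ⟨z.re, z.im, 0, 0⟩

/-- The quaternion imaginary unit `j`. -/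
def jH : Quat := ⟨0, 0, 1, 0⟩

/-- The first complex component of a quaternion: `q = c2q (qd q) + jH * c2q (qc q)`. -/
def qd (q : Quat) : ℂ := ⟨q.re, q.imI⟩

/-- The second complex component of a quaternion. -/
def qc (q : Quat) : ℂ := ⟨q.imJ, -q.imK⟩

/-- A third-order tensor, given by its family of frontal slices. -/
abbrev Tensor (α : Type*) (n₁ n₂ n₃ : ℕ) := Fin n₃ → Matrix (Fin n₁) (Fin n₂) α

/-- The complex tensor `A_d` in the decomposition `A = A_d + j·A_c`. -/
def Td {n₁ n₂ n₃ : ℕ} (A : Tensor Quat n₁ n₂ n₃) : Tensor ℂ n₁ n₂ n₃ :=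
  fun k i j => qd (A k i j)

/-- The complex tensor `A_c` in the decomposition `A = A_d + j·A_c`. -/
def Tc {n₁ n₂ n₃ : ℕ} (A : Tensor Quat n₁ n₂ n₃) : Tensor ℂ n₁ n₂ n₃ :=
  fun k i j => qc (A k i j)

/-- The normalized `n × n` DFT matrix (0-indexed). -/
def Fmat (n : ℕ) : Matrix (Fin n) (Fin n) ℂ :=
  fun s t => (((Real.sqrt (n : ℝ)) : ℂ))⁻¹ *
    Complex.exp ((-2 * (Real.pi : ℂ) * Complex.I * ((s : ℕ) : ℂ) * ((t : ℕ) : ℂ)) / (n : ℂ))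

/-- The flip permutation matrix `P_n` (0-indexed: `P_{s,t} = 1` iff `s + t ≡ 0 (mod n)`). -/
def Pmat (n : ℕ) : Matrix (Fin n) (Fin n) ℂ :=
  fun s t => if ((s : ℕ) + (t : ℕ)) % n = 0 then 1 else 0

/-- Left scalar multiplication of a quaternion matrix by a quaternion. -/
def lsmul {m n : Type*} (q : Quat) (M : Matrix m n Quat) : Matrix m n Quat :=
  fun i j => q * M i j

/-- Right scalar multiplication of a quaternion matrix by a quaternion. -/
def rsmul {m n : Type*} (q : Quat) (M : Matrix m n Quat) : Matrix m n Quat :=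
  fun i j => M i j * q

/-- The block circulant matrix of a third-order tensor. -/
def bcirc {α : Type*} {n₁ n₂ n₃ : ℕ} (T : Tensor α n₁ n₂ n₃) :
    Matrix (Fin n₃ × Fin n₁) (Fin n₃ × Fin n₂) α :=
  fun p q => T (p.1 - q.1) p.2 q.2

/-- The z-block circulant matrix `bcirc_z(A) = bcirc(A_d) + j·bcirc(A_c)·(P_{n₃} ⊗ I_{n₂})`. -/
def bcircz {n₁ n₂ n₃ : ℕ} (A : Tensor Quat n₁ n₂ n₃) :
    Matrix (Fin n₃ × Fin n₁) (Fin n₃ × Fin n₂) Quat :=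
  (bcirc (Td A)).map c2q +
    lsmul jH ((bcirc (Tc A) * (Pmat n₃ ⊗ₖ (1 : Matrix (Fin n₂) (Fin n₂) ℂ))).map c2q)

/-- `unfold`: stack the frontal slices vertically. -/
def unfoldT {α : Type*} {n₁ n₂ n₃ : ℕ} (T : Tensor α n₁ n₂ n₃) :
    Matrix (Fin n₃ × Fin n₁) (Fin n₂) α :=
  fun p j => T p.1 p.2 j

/-- `fold`: the inverse of `unfold`. -/
def foldT {α : Type*} {n₁ n₂ n₃ : ℕ} (M : Matrix (Fin n₃ × Fin n₁) (Fin n₂) α) :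
    Tensor α n₁ n₂ n₃ :=
  fun k i j => M (k, i) j

/-- The QT-product `A *_Q B = fold(bcirc_z(A)·unfold(B))`. -/
def qtmul {n₁ r n₂ n₃ : ℕ} (A : Tensor Quat n₁ r n₃) (B : Tensor Quat r n₂ n₃) :
    Tensor Quat n₁ n₂ n₃ :=
  foldT (bcircz A * unfoldT B)

/-- The mode-3 quaternion DFT
`Â(i,j,:) = √n₃·F_{n₃}·A_d(i,j,:) + j·√n₃·P_{n₃}·F_{n₃}·A_c(i,j,:)`, tube-wise. -/
def hatT {n₁ n₂ n₃ : ℕ} (A : Tensor Quat n₁ n₂ n₃) : Tensor Quat n₁ n₂ n₃ :=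
  fun k i j =>
    c2q (((Real.sqrt (n₃ : ℝ)) : ℂ) * ∑ t, Fmat n₃ k t * Td A t i j) +
    jH * c2q (((Real.sqrt (n₃ : ℝ)) : ℂ) * ∑ t, (Pmat n₃ * Fmat n₃) k t * Tc A t i j)

/-- `diag(Â)`: the block diagonal matrix with the frontal slices as diagonal blocks. -/
def blkDiag {α : Type*} [Zero α] {n₁ n₂ n₃ : ℕ} (T : Tensor α n₁ n₂ n₃) :
    Matrix (Fin n₃ × Fin n₁) (Fin n₃ × Fin n₂) α :=
  fun p q => if p.1 = q.1 then T p.1 p.2 q.2 else 0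

/-- Conjugate transpose of a complex tensor: conjugate-transpose each slice and
reverse the order of slices `2,…,n₃` (i.e. slice `k ↦ -k` in 0-indexing). -/
def cConjT {n₁ n₂ n₃ : ℕ} (T : Tensor ℂ n₁ n₂ n₃) : Tensor ℂ n₂ n₁ n₃ :=
  fun k => (T (-k))ᴴ

/-- Conjugate transpose of a quaternion tensor, defined by
`unfold(A*) = unfold(A_d*) − (P_{n₃} ⊗ I_{n₂})·unfold(A_c*)·j`. -/
def tConjT {n₁ n₂ n₃ : ℕ} (A : Tensor Quat n₁ n₂ n₃) : Tensor Quat n₂ n₁ n₃ :=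
  foldT ((unfoldT (cConjT (Td A))).map c2q -
    rsmul jH (((Pmat n₃ ⊗ₖ (1 : Matrix (Fin n₂) (Fin n₂) ℂ)) *
      unfoldT (cConjT (Tc A))).map c2q))

/-- The identity tensor: identity matrix as first frontal slice, zero elsewhere. -/
def idT (n n₃ : ℕ) : Tensor Quat n n n₃ :=
  fun k => if (k : ℕ) = 0 then (1 : Matrix (Fin n) (Fin n) Quat) else 0

/-- A quaternion tensor is unitary if `U* *_Q U = U *_Q U* = I`. -/
def IsUnitaryT {n n₃ : ℕ} (U : Tensor Quat n n n₃) : Prop :=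
  qtmul (tConjT U) U = idT n n₃ ∧ qtmul U (tConjT U) = idT n n₃

/-- A quaternion tensor is Hermitian if `H* = H`. -/
def IsHermitianT {n n₃ : ℕ} (H : Tensor Quat n n n₃) : Prop := tConjT H = H

/-- A quaternion matrix `M` is positive semidefinite if `x*·M·x` is a nonnegative
real number for every quaternion vector `x`. -/
def IsPSDMat {m : Type*} [Fintype m] (M : Matrix m m Quat) : Prop :=
  ∀ x : m → Quat, ∃ r : ℝ, 0 ≤ r ∧ (star x) ⬝ᵥ M.mulVec x = (r : Quat)

section MatrixSVD

instance : StarModule ℝ (Quaternion ℝ) := ⟨Quaternion.star_smul⟩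

theorem star_mul_self_eq_norm_sq (q : Quat) : star q * q = ((‖q‖ ^ 2 : ℝ) : Quat) := by
  rw [Quaternion.star_mul_self, Quaternion.normSq_eq_norm_mul_self, sq]

/-- The squared Euclidean norm of a quaternion column is the real number `wᴴ * w`. -/
theorem conjTranspose_mul_self_col {n : Type*} [Fintype n] (w : Matrix n Unit Quat) :
    wᴴ * w = (∑ i, ‖w i ()‖ ^ 2) • (1 : Matrix Unit Unit Quat) := by
  ext1 a b
  rw [Matrix.mul_apply, Matrix.smul_apply, Matrix.one_apply_eq, Finset.sum_smul]
  refine Finset.sum_congr rfl fun i _ => ?_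
  rw [Matrix.conjTranspose_apply, star_mul_self_eq_norm_sq, ← Quaternion.coe_mul_eq_smul, mul_one]

variable {m n : Type*} [Fintype m] [Fintype n] [DecidableEq m] [DecidableEq n]

/-- The Householder reflection along the quaternion column `w`. -/
def householder (w : Matrix n Unit Quat) : Matrix n n Quat :=
  1 - (2 / ∑ i, ‖w i ()‖ ^ 2) • (w * wᴴ)

theorem householder_conjTranspose (w : Matrix n Unit Quat) :
    (householder w)ᴴ = householder w := by
  simp [householder, Matrix.conjTranspose_sub, Matrix.conjTranspose_smul]

theorem householder_mul_self (w : Matrix n Unit Quat) : householder w * householder w = 1 := by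
  have h : w * wᴴ * (w * wᴴ) = (∑ i, ‖w i ()‖ ^ 2) • (w * wᴴ) := by
    rw [Matrix.mul_assoc, ← Matrix.mul_assoc wᴴ, conjTranspose_mul_self_col]
    simp
  unfold householder
  set N := ∑ i, ‖w i ()‖ ^ 2
  have hc : (2 / N) * (2 / N * N) = 2 / N + 2 / N := by
    by_cases hN : N = 0
    · simp [hN]
    · field_simp
      norm_num
  simp only [Matrix.sub_mul, Matrix.mul_sub, Matrix.smul_mul, Matrix.mul_smul, Matrix.one_mul,
    Matrix.mul_one, h, smul_sub, smul_smul, hc, add_smul]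
  abel

theorem householder_mem_unitary (w : Matrix n Unit Quat) :
    householder w ∈ unitary (Matrix n n Quat) := by
  rw [Unitary.mem_iff, Matrix.star_eq_conjTranspose, householder_conjTranspose]
  exact ⟨householder_mul_self w, householder_mul_self w⟩

/-- If `‖x‖ = ‖y‖` and `yᴴ * x` is real then the reflection along `x - y` sends `x` to `y`. -/
theorem householder_sub_mul (x y : Matrix n Unit Quat) (r : ℝ)
    (hn : ∑ i, ‖x i ()‖ ^ 2 = ∑ i, ‖y i ()‖ ^ 2)
    (hr : yᴴ * x = r • (1 : Matrix Unit Unit Quat)) :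
    householder (x - y) * x = y := by
  have hr' : xᴴ * y = r • (1 : Matrix Unit Unit Quat) := by
    have := congrArg Matrix.conjTranspose hr
    simpa [Matrix.conjTranspose_mul, Matrix.conjTranspose_smul] using this
  set M := ∑ i, ‖x i ()‖ ^ 2
  have hxx : xᴴ * x = M • (1 : Matrix Unit Unit Quat) := conjTranspose_mul_self_col x
  have hyy : yᴴ * y = M • (1 : Matrix Unit Unit Quat) := by
    rw [conjTranspose_mul_self_col y, ← hn]
  have hww := conjTranspose_mul_self_col (x - y)
  have hwx : (x - y)ᴴ * x = (M - r) • (1 : Matrix Unit Unit Quat) := by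
    rw [Matrix.conjTranspose_sub, Matrix.sub_mul, hxx, hr, sub_smul]
  have hN : ∑ i, ‖(x - y) i ()‖ ^ 2 = 2 * (M - r) := by
    have h1 : (x - y)ᴴ * (x - y) = (2 * (M - r)) • (1 : Matrix Unit Unit Quat) := by
      rw [Matrix.mul_sub, hwx, Matrix.conjTranspose_sub, Matrix.sub_mul, hr', hyy, ← sub_smul,
        ← sub_smul]
      congr 1
      ring
    exact smul_left_injective ℝ one_ne_zero (hww.symm.trans h1)
  unfold householder
  rw [Matrix.sub_mul, Matrix.smul_mul, Matrix.mul_assoc, hwx, Matrix.mul_smul, smul_smul,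
    Matrix.mul_one, Matrix.one_mul, hN]
  by_cases h0 : M - r = 0
  · have hz : ∀ i, (x - y) i () = 0 := by
      rw [h0, mul_zero, Finset.sum_eq_zero_iff_of_nonneg fun _ _ => by positivity] at hN
      intro i
      simpa using hN i (Finset.mem_univ i)
    have : x - y = 0 := by
      ext1 i j
      exact hz i
    rw [this, smul_zero, sub_zero]
    exact sub_eq_zero.mp this
  · have : 2 / (2 * (M - r)) * (M - r) = 1 := by field_simp
    rw [this, one_smul]
    abel

/-- Any quaternion column can be rotated onto a multiple of a given coordinate vector. -/
theorem exists_unitary_mul_col_eq (x : Matrix n Unit Quat) (i₀ : n) :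
    ∃ G ∈ unitary (Matrix n n Quat), ∃ q : Quat, ‖q‖ ^ 2 = ∑ i, ‖x i ()‖ ^ 2 ∧
      G * x = Matrix.of fun i _ => if i = i₀ then q else 0 := by
  set R := Real.sqrt (∑ i, ‖x i ()‖ ^ 2)
  have hR2 : R ^ 2 = ∑ i, ‖x i ()‖ ^ 2 := Real.sq_sqrt (by positivity)
  obtain ⟨u, hu, s, hs⟩ : ∃ u : Quat, ‖u‖ = 1 ∧ ∃ s : ℝ, star u * x i₀ () = (s : Quat) := by
    by_cases h : x i₀ () = 0
    · exact ⟨1, by simp, 0, by simp [h]⟩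
    · have h' : ‖x i₀ ()‖ ≠ 0 := by simpa using h
      refine ⟨‖x i₀ ()‖⁻¹ • x i₀ (), ?_, ‖x i₀ ()‖⁻¹ * ‖x i₀ ()‖ ^ 2, ?_⟩
      · rw [norm_smul, norm_inv, norm_norm, inv_mul_cancel₀ h']
      · rw [star_smul, smul_mul_assoc, star_mul_self_eq_norm_sq, star_trivial,
          ← Quaternion.coe_mul_eq_smul]
        push_cast
        rfl
  have hq : ‖R • u‖ ^ 2 = ∑ i, ‖x i ()‖ ^ 2 := by
    rw [norm_smul, hu, mul_one, Real.norm_eq_abs, sq_abs, hR2]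
  set y : Matrix n Unit Quat := Matrix.of fun i _ => if i = i₀ then R • u else 0 with hy
  refine ⟨householder (x - y), householder_mem_unitary _, R • u, hq,
    householder_sub_mul x y (R * s) ?_ ?_⟩
  · rw [← hq, Finset.sum_eq_single i₀]
    · simp [hy]
    · intro b _ hb
      simp [hy, hb]
    · simp
  · ext1 a b
    rw [Matrix.mul_apply, Finset.sum_eq_single i₀]
    · simp only [hy, Matrix.conjTranspose_apply, Matrix.of_apply, if_true, star_smul, star_trivial,
        smul_mul_assoc]
      rw [hs, Matrix.smul_apply, Matrix.one_apply_eq, mul_smul, ← Quaternion.coe_mul_eq_smul s,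
        mul_one]
    · intro c _ hc
      simp [hy, hc]
    · simp

theorem isCompact_unitary_quat : IsCompact (unitary (Matrix n n Quat) : Set (Matrix n n Quat)) := by
  have hb : IsCompact (Set.univ.pi fun _ : n => Set.univ.pi fun _ : n =>
      Metric.closedBall (0 : Quat) 1) :=
    isCompact_univ_pi fun _ => isCompact_univ_pi fun _ => by
      have : ProperSpace (Quaternion ℝ) := FiniteDimensional.proper_real _
      exact isCompact_closedBall _ _
  refine IsCompact.of_isClosed_subset (X := Matrix n n Quat) hb ?_ ?_
  · have : (unitary (Matrix n n Quat) : Set (Matrix n n Quat)) =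
        {U | Uᴴ * U = 1} ∩ {U | U * Uᴴ = 1} := by
      ext U
      exact Unitary.mem_iff
    rw [this]
    exact (isClosed_eq (by fun_prop) continuous_const).inter
      (isClosed_eq (by fun_prop) continuous_const)
  · intro U hU i _ j _
    have h1 : ∑ k, ‖U k j‖ ^ 2 = 1 := by
      refine smul_left_injective ℝ (one_ne_zero (α := Matrix Unit Unit Quat)) ?_
      refine (conjTranspose_mul_self_col (Matrix.of fun k _ => U k j)).symm.trans ?_
      ext1 a b
      have h := congrFun₂ (Unitary.mem_iff.mp hU).1 j j
      rw [Matrix.one_apply_eq] at h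
      exact h.trans (by simp)
    have h2 : ‖U i j‖ ^ 2 ≤ ∑ k, ‖U k j‖ ^ 2 :=
      Finset.single_le_sum (f := fun k => ‖U k j‖ ^ 2) (fun _ _ => by positivity)
        (Finset.mem_univ i)
    rw [mem_closedBall_zero_iff]
    exact (sq_le_one_iff₀ (norm_nonneg _)).mp (h2.trans_eq h1)

/-- A column whose entry at `i₀` cannot grow under unitary rotations is supported at `i₀`. -/
theorem col_eq_zero_of_maximal (x : Matrix n Unit Quat) (i₀ : n)
    (h : ∀ G ∈ unitary (Matrix n n Quat), ‖(G * x) i₀ ()‖ ≤ ‖x i₀ ()‖) (i : n) (hi : i ≠ i₀) :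
    x i () = 0 := by
  obtain ⟨G, hG, q, hq, hGx⟩ := exists_unitary_mul_col_eq x i₀
  have h1 := h G hG
  rw [hGx] at h1
  simp only [Matrix.of_apply, if_true] at h1
  have h2 : ‖q‖ ^ 2 ≤ ‖x i₀ ()‖ ^ 2 := by gcongr
  have h3 : ‖x i₀ ()‖ ^ 2 + ‖x i ()‖ ^ 2 ≤ ∑ i, ‖x i ()‖ ^ 2 := by
    rw [← Finset.sum_pair (f := fun k => ‖x k ()‖ ^ 2) hi.symm]
    exact Finset.sum_le_sum_of_subset_of_nonneg (Finset.subset_univ _) fun _ _ _ => by positivity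
  have h4 : ‖x i ()‖ ^ 2 ≤ 0 := by linarith
  simpa using le_antisymm h4 (by positivity)

/-- Some unitary equivalence clears the row and the column of a given entry. -/
theorem exists_unitary_clear_cross (A : Matrix m n Quat) (i₀ : m) (j₀ : n) :
    ∃ U ∈ unitary (Matrix m m Quat), ∃ V ∈ unitary (Matrix n n Quat),
      (∀ i, i ≠ i₀ → (U * A * V) i j₀ = 0) ∧ (∀ j, j ≠ j₀ → (U * A * V) i₀ j = 0) := by
  obtain ⟨⟨U, V⟩, ⟨hU, hV⟩, hmax⟩ :=
    ((isCompact_unitary_quat (n := m)).prod (isCompact_unitary_quat (n := n))).exists_isMaxOn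
      ⟨(1, 1), one_mem _, one_mem _⟩
      (f := fun p : Matrix m m Quat × Matrix n n Quat => ‖(p.1 * A * p.2) i₀ j₀‖)
      (Continuous.continuousOn (by fun_prop))
  refine ⟨U, hU, V, hV, fun i hi => ?_, fun j hj => ?_⟩
  · refine col_eq_zero_of_maximal (Matrix.of fun i _ => (U * A * V) i j₀) i₀ (fun G hG => ?_) i hi
    have h := isMaxOn_iff.mp hmax (G * U, V) ⟨mul_mem hG hU, hV⟩
    have h1 : (G * Matrix.of fun i (_ : Unit) => (U * A * V) i j₀) i₀ () =
        (G * U * A * V) i₀ j₀ := by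
      rw [Matrix.mul_assoc G, Matrix.mul_assoc G]
      rfl
    rw [h1]
    exact h
  · have := col_eq_zero_of_maximal (Matrix.of fun j _ => star ((U * A * V) i₀ j)) j₀
      (fun G hG => ?_) j hj
    · simpa using this
    · have h := isMaxOn_iff.mp hmax (U, V * star G) ⟨hU, mul_mem hV (Unitary.star_mem hG)⟩
      have h1 : (G * Matrix.of fun j (_ : Unit) => star ((U * A * V) i₀ j)) j₀ () =
          star ((U * A * (V * star G)) i₀ j₀) := by
        rw [← Matrix.mul_assoc (U * A), Matrix.mul_apply, Matrix.mul_apply, star_sum]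
        simp
      rw [h1]
      simpa using h

/-- The block diagonal matrix with a corner entry `c` and a lower right block `M`. -/
def cornerBlock {a b : ℕ} (c : Quat) (M : Matrix (Fin a) (Fin b) Quat) :
    Matrix (Fin (a + 1)) (Fin (b + 1)) Quat :=
  Matrix.of (Fin.cons (Fin.cons c 0) fun i => Fin.cons 0 (M i))

theorem cornerBlock_mul {a b d : ℕ} (c c' : Quat) (M : Matrix (Fin a) (Fin b) Quat)
    (M' : Matrix (Fin b) (Fin d) Quat) :
    cornerBlock c M * cornerBlock c' M' = cornerBlock (c * c') (M * M') := by
  ext1 i j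
  rw [Matrix.mul_apply, Fin.sum_univ_succ]
  refine Fin.cases ?_ (fun i => ?_) i <;> refine Fin.cases ?_ (fun j => ?_) j <;>
    simp [cornerBlock, Matrix.mul_apply]

theorem cornerBlock_conjTranspose {a b : ℕ} (c : Quat) (M : Matrix (Fin a) (Fin b) Quat) :
    (cornerBlock c M)ᴴ = cornerBlock (star c) Mᴴ := by
  ext1 i j
  refine Fin.cases ?_ (fun i => ?_) i <;> refine Fin.cases ?_ (fun j => ?_) j <;>
    simp [cornerBlock]

theorem cornerBlock_one {a : ℕ} : cornerBlock 1 (1 : Matrix (Fin a) (Fin a) Quat) = 1 := by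
  ext1 i j
  refine Fin.cases ?_ (fun i => ?_) i <;> refine Fin.cases ?_ (fun j => ?_) j <;>
    simp [cornerBlock, Matrix.one_apply, Fin.succ_ne_zero, (Fin.succ_ne_zero _).symm]

theorem cornerBlock_mem_unitary {a : ℕ} {M : Matrix (Fin a) (Fin a) Quat}
    (hM : M ∈ unitary (Matrix (Fin a) (Fin a) Quat)) :
    cornerBlock 1 M ∈ unitary (Matrix (Fin (a + 1)) (Fin (a + 1)) Quat) := by
  rw [Unitary.mem_iff, Matrix.star_eq_conjTranspose] at *
  simp [cornerBlock_conjTranspose, cornerBlock_mul, hM.1, hM.2, cornerBlock_one]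

/-- Singular value decomposition of quaternion matrices. -/
theorem exists_quaternion_svd (a b : ℕ) (A : Matrix (Fin a) (Fin b) Quat) :
    ∃ U ∈ unitary (Matrix (Fin a) (Fin a) Quat), ∃ V ∈ unitary (Matrix (Fin b) (Fin b) Quat),
      ∃ S : Matrix (Fin a) (Fin b) Quat,
        (∀ (i : Fin a) (j : Fin b), (i : ℕ) ≠ (j : ℕ) → S i j = 0) ∧ A = U * S * Vᴴ := by
  induction a generalizing b with
  | zero => exact ⟨1, one_mem _, 1, one_mem _, A, fun i => i.elim0, by ext1 i; exact i.elim0⟩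
  | succ a ih =>
    cases b with
    | zero => exact ⟨1, one_mem _, 1, one_mem _, A, fun _ j => j.elim0, by ext1 i j; exact j.elim0⟩
    | succ b =>
      obtain ⟨P, hP, Q, hQ, hcol, hrow⟩ := exists_unitary_clear_cross A 0 0
      obtain ⟨U, hU, V, hV, S, hS, hB⟩ := ih b ((P * A * Q).submatrix Fin.succ Fin.succ)
      have hPAQ : P * A * Q = cornerBlock ((P * A * Q) 0 0)
          ((P * A * Q).submatrix Fin.succ Fin.succ) := by
        ext1 i j
        refine Fin.cases ?_ (fun i => ?_) i <;> refine Fin.cases ?_ (fun j => ?_) j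
        · simp [cornerBlock]
        · simpa [cornerBlock] using hrow j.succ (Fin.succ_ne_zero j)
        · simpa [cornerBlock] using hcol i.succ (Fin.succ_ne_zero i)
        · simp [cornerBlock]
      refine ⟨star P * cornerBlock 1 U, mul_mem (Unitary.star_mem hP) (cornerBlock_mem_unitary hU),
        Q * cornerBlock 1 V, mul_mem hQ (cornerBlock_mem_unitary hV),
        cornerBlock ((P * A * Q) 0 0) S, ?_, ?_⟩
      · intro i j
        refine Fin.cases ?_ (fun i => ?_) i <;> refine Fin.cases ?_ (fun j => ?_) j
        · simp
        · simp [cornerBlock]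
        · simp [cornerBlock]
        · intro hij
          simpa [cornerBlock] using hS i j (by simpa using hij)
      · have hA : A = star P * (P * A * Q) * star Q := by
          have h1 := (Unitary.mem_iff.mp hP).1
          have h2 := (Unitary.mem_iff.mp hQ).2
          rw [← Matrix.mul_assoc, ← Matrix.mul_assoc, h1, Matrix.one_mul, Matrix.mul_assoc, h2,
            Matrix.mul_one]
        conv_lhs => rw [hA, hPAQ, hB]
        simp only [Matrix.conjTranspose_mul, Matrix.star_eq_conjTranspose, Matrix.mul_assoc,
          cornerBlock_conjTranspose]
        rw [← Matrix.mul_assoc (cornerBlock _ S), cornerBlock_mul, ← Matrix.mul_assoc _ _ Qᴴ,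
          ← Matrix.mul_assoc _ _ Qᴴ, cornerBlock_mul]
        simp [Matrix.mul_assoc]

end MatrixSVD

section QuaternionDFT

open scoped Quaternion

@[simp] theorem re_c2q (z : ℂ) : (c2q z).re = z.re := rfl
@[simp] theorem imI_c2q (z : ℂ) : (c2q z).imI = z.im := rfl
@[simp] theorem imJ_c2q (z : ℂ) : (c2q z).imJ = 0 := rfl
@[simp] theorem imK_c2q (z : ℂ) : (c2q z).imK = 0 := rfl
@[simp] theorem re_jH : jH.re = 0 := rfl
@[simp] theorem imI_jH : jH.imI = 0 := rfl
@[simp] theorem imJ_jH : jH.imJ = 1 := rfl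
@[simp] theorem imK_jH : jH.imK = 0 := rfl

theorem c2q_add (z w : ℂ) : c2q (z + w) = c2q z + c2q w := by
  apply Quaternion.ext <;> simp

theorem c2q_mul (z w : ℂ) : c2q (z * w) = c2q z * c2q w := by
  apply Quaternion.ext <;> simp

/-- `c2q` as a ring homomorphism. -/
def c2qHom : ℂ →+* Quat where
  toFun := c2q
  map_one' := by apply Quaternion.ext <;> simp
  map_mul' := c2q_mul
  map_zero' := by apply Quaternion.ext <;> simp
  map_add' := c2q_add

theorem c2qHom_apply (z : ℂ) : c2qHom z = c2q z := rfl

theorem c2qHom_mul_jH (z : ℂ) : c2qHom z * jH = jH * c2qHom (star z) := by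
  apply Quaternion.ext <;> simp [c2qHom_apply]

theorem c2qHom_qd_add (q : Quat) : c2qHom (qd q) + jH * c2qHom (qc q) = q := by
  apply Quaternion.ext <;> simp [c2qHom_apply, qd, qc]

theorem star_eq_c2qHom_sub (q : Quat) :
    star q = c2qHom (star (qd q)) - c2qHom (star (qc q)) * jH := by
  apply Quaternion.ext <;> simp [c2qHom_apply, qd, qc]

theorem star_c2qHom (z : ℂ) : star (c2qHom z) = c2qHom (star z) := by
  apply Quaternion.ext <;> simp [c2qHom_apply]

variable {N n₁ n₂ n₃ : ℕ}

theorem Pmat_apply (k t : Fin (N + 1)) : Pmat (N + 1) k t = if t = -k then 1 else 0 := by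
  have : ((k : ℕ) + (t : ℕ)) % (N + 1) = 0 ↔ t = -k := by
    rw [eq_neg_iff_add_eq_zero, add_comm t, Fin.ext_iff, Fin.val_add, Fin.val_zero]
  simp only [Pmat, this]

theorem qtmul_apply (A : Tensor Quat n₁ n₂ (N + 1)) (B : Tensor Quat n₂ n₃ (N + 1))
    (k : Fin (N + 1)) (i : Fin n₁) (j : Fin n₃) :
    qtmul A B k i j = ∑ s, ∑ r, (c2qHom (qd (A (k - s) i r)) + jH * c2qHom (qc (A (k + s) i r))) *
      B s r j := by
  have h (s : Fin (N + 1)) (r : Fin n₂) :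
      (bcirc (Tc A) * (Pmat (N + 1) ⊗ₖ (1 : Matrix (Fin n₂) (Fin n₂) ℂ))) (k, i) (s, r) =
        qc (A (k + s) i r) := by
    rw [Matrix.mul_apply, Finset.sum_eq_single (-s, r)]
    · simp [bcirc, Tc, Pmat_apply]
    · rintro ⟨t, l⟩ _ hne
      by_cases hl : l = r
      · subst hl
        have : s ≠ -t := fun h => hne (by simp [h])
        simp [Pmat_apply, this]
      · simp [hl]
    · simp
  rw [qtmul, foldT, Matrix.mul_apply, Fintype.sum_prod_type]
  refine Finset.sum_congr rfl fun s _ => Finset.sum_congr rfl fun r _ => ?_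
  simp only [bcircz, Matrix.add_apply, lsmul, Matrix.map_apply, h, unfoldT]
  rfl

theorem tConjT_apply (A : Tensor Quat n₁ n₂ (N + 1)) (k : Fin (N + 1)) (i : Fin n₂)
    (j : Fin n₁) :
    tConjT A k i j = c2qHom (star (qd (A (-k) j i))) - c2qHom (star (qc (A k j i))) * jH := by
  have h : ((Pmat (N + 1) ⊗ₖ (1 : Matrix (Fin n₂) (Fin n₂) ℂ)) * unfoldT (cConjT (Tc A))) (k, i) j
      = star (qc (A k j i)) := by
    rw [Matrix.mul_apply, Finset.sum_eq_single (-k, i)]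
    · simp [unfoldT, cConjT, Tc, Pmat_apply]
    · rintro ⟨t, l⟩ _ hne
      by_cases hl : i = l
      · subst hl
        have : t ≠ -k := fun h => hne (by simp [h])
        simp [Pmat_apply, this]
      · simp [hl]
    · simp
  simp only [tConjT, foldT, Matrix.sub_apply, rsmul, Matrix.map_apply, h]
  rfl

/-- The character table of `ℤ/(N+1)ℤ`. -/
def charTable (m t : Fin (N + 1)) : ℂ :=
  ZMod.stdAddChar (N := N + 1) ((m : ZMod (N + 1)) * (t : ZMod (N + 1)))

theorem charTable_add (m s t : Fin (N + 1)) :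
    charTable m (s + t) = charTable m s * charTable m t :=
  (congrArg ZMod.stdAddChar (mul_add (R := ZMod (N + 1)) m s t)).trans (AddChar.map_add_eq_mul _ _ _)

theorem charTable_zero (m : Fin (N + 1)) : charTable m 0 = 1 :=
  (congrArg ZMod.stdAddChar (mul_zero (M₀ := ZMod (N + 1)) m)).trans (AddChar.map_zero_eq_one _)

theorem charTable_comm (m t : Fin (N + 1)) : charTable m t = charTable t m :=
  congrArg ZMod.stdAddChar (mul_comm (G := ZMod (N + 1)) m t)

theorem star_charTable (m t : Fin (N + 1)) : star (charTable m t) = charTable m (-t) :=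
  ((congrArg ZMod.stdAddChar (mul_neg (α := ZMod (N + 1)) m t)).trans
    (AddChar.map_neg_eq_conj _ _)).symm

theorem sum_charTable (t : Fin (N + 1)) :
    ∑ m, charTable m t = if t = 0 then (N + 1 : ℂ) else 0 := by
  have := AddChar.sum_mulShift (R := ZMod (N + 1)) t (ZMod.isPrimitive_stdAddChar (N + 1))
  rw [ZMod.card] at this
  refine Eq.trans ?_ (this.trans ?_)
  · rfl
  · push_cast
    rfl

theorem sum_charTable_mul (s t : Fin (N + 1)) :
    ∑ m, charTable m s * charTable m (-t) = if s = t then (N + 1 : ℂ) else 0 := by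
  simp only [← charTable_add, sum_charTable, ← sub_eq_add_neg, sub_eq_zero]

theorem charTable_neg_comm (m t : Fin (N + 1)) : charTable m (-t) = charTable t (-m) := by
  rw [← star_charTable, charTable_comm, star_charTable]

/-- The Fourier transform of a quaternion tensor along its third mode, with complex
coefficients acting from the left. -/
def tubeDFT (A : Tensor Quat n₁ n₂ (N + 1)) : Tensor Quat n₁ n₂ (N + 1) :=
  fun m => Matrix.of fun i j => ∑ t, c2qHom (charTable m t) * A t i j

/-- The inverse of `tubeDFT`. -/
def tubeInvDFT (B : Tensor Quat n₁ n₂ (N + 1)) : Tensor Quat n₁ n₂ (N + 1) :=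
  fun t => Matrix.of fun i j => ∑ m, c2qHom ((N + 1 : ℂ)⁻¹ * charTable m (-t)) * B m i j

theorem sum_c2qHom_kernel (x : Fin (N + 1) → Quat) (f : Fin (N + 1) → Fin (N + 1) → ℂ)
    (k : Fin (N + 1)) (hf : ∀ t, ∑ m, f m t = if t = k then 1 else 0) :
    ∑ m, ∑ t, c2qHom (f m t) * x t = x k := by
  rw [Finset.sum_comm]
  simp_rw [← Finset.sum_mul, ← map_sum, hf]
  simp [apply_ite c2qHom]

theorem tubeInvDFT_tubeDFT (A : Tensor Quat n₁ n₂ (N + 1)) : tubeInvDFT (tubeDFT A) = A := by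
  ext1 k
  ext1 i j
  simp only [tubeInvDFT, tubeDFT, Matrix.of_apply, Finset.mul_sum, ← mul_assoc, ← map_mul]
  refine sum_c2qHom_kernel (fun t => A t i j) _ k fun t => ?_
  have hN : (N + 1 : ℂ) ≠ 0 := by exact_mod_cast N.succ_ne_zero
  simp_rw [mul_assoc, ← Finset.mul_sum, mul_comm (charTable _ (-k)), sum_charTable_mul]
  split_ifs <;> simp [hN]

theorem tubeDFT_tubeInvDFT (B : Tensor Quat n₁ n₂ (N + 1)) : tubeDFT (tubeInvDFT B) = B := by
  ext1 k
  ext1 i j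
  simp only [tubeInvDFT, tubeDFT, Matrix.of_apply, Finset.mul_sum, ← mul_assoc, ← map_mul]
  refine sum_c2qHom_kernel (fun t => B t i j) _ k fun t => ?_
  have hN : (N + 1 : ℂ) ≠ 0 := by exact_mod_cast N.succ_ne_zero
  have h (m : Fin (N + 1)) : charTable k m * (N + 1 : ℂ)⁻¹ * charTable t (-m) =
      (N + 1 : ℂ)⁻¹ * (charTable m k * charTable m (-t)) := by
    rw [charTable_comm k, charTable_neg_comm t, mul_assoc, mul_left_comm]
  simp_rw [h, ← Finset.mul_sum, sum_charTable_mul]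
  by_cases h : t = k
  · simp [h, hN]
  · simp [h, Ne.symm h]

theorem tubeDFT_injective :
    Function.Injective (tubeDFT : Tensor Quat n₁ n₂ (N + 1) → Tensor Quat n₁ n₂ (N + 1)) :=
  Function.LeftInverse.injective tubeInvDFT_tubeDFT

theorem c2qHom_mul_jH_mul (z w : ℂ) (q : Quat) :
    c2qHom z * (jH * c2qHom w * q) = jH * c2qHom w * (c2qHom (star z) * q) := by
  rw [← mul_assoc, ← mul_assoc, c2qHom_mul_jH, mul_assoc jH, mul_assoc jH, ← mul_assoc (jH * _),
    mul_assoc jH, ← map_mul, ← map_mul, mul_comm, mul_assoc]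

theorem tubeDFT_qtmul (A : Tensor Quat n₁ n₂ (N + 1)) (B : Tensor Quat n₂ n₃ (N + 1))
    (m : Fin (N + 1)) : tubeDFT (qtmul A B) m = tubeDFT A m * tubeDFT B m := by
  ext1 i j
  simp only [tubeDFT, Matrix.of_apply, qtmul_apply, Matrix.mul_apply, Finset.mul_sum]
  have hcomm : ∀ s : Fin (N + 1), ∑ k, ∑ r, c2qHom (charTable m k) *
      ((c2qHom (qd (A (k - s) i r)) + jH * c2qHom (qc (A (k + s) i r))) * B s r j) =
      ∑ r, ∑ u, c2qHom (charTable m u) * A u i r * (c2qHom (charTable m s) * B s r j) := by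
    intro s
    rw [Finset.sum_comm]
    refine Finset.sum_congr rfl fun r _ => ?_
    have hd : ∑ k, c2qHom (charTable m k) * (c2qHom (qd (A (k - s) i r)) * B s r j) =
        ∑ u, c2qHom (charTable m u) * c2qHom (qd (A u i r)) *
          (c2qHom (charTable m s) * B s r j) := by
      rw [← Equiv.sum_comp (Equiv.addRight s)]
      refine Finset.sum_congr rfl fun u _ => ?_
      rw [Equiv.coe_addRight, add_sub_cancel_right, charTable_add]
      simp only [← mul_assoc, ← map_mul]
      congr 2
      ring
    have hc : ∑ k, c2qHom (charTable m k) * (jH * c2qHom (qc (A (k + s) i r)) * B s r j) =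
        ∑ u, c2qHom (charTable m u) * (jH * c2qHom (qc (A u i r))) *
          (c2qHom (charTable m s) * B s r j) := by
      rw [← Equiv.sum_comp (Equiv.subRight s)]
      refine Finset.sum_congr rfl fun u _ => ?_
      rw [Equiv.subRight_apply, sub_add_cancel, sub_eq_add_neg, charTable_add, map_mul, mul_assoc,
        c2qHom_mul_jH_mul, star_charTable, neg_neg, ← mul_assoc]
    simp only [add_mul, mul_add, Finset.sum_add_distrib]
    rw [hd, hc, ← Finset.sum_add_distrib]
    refine Finset.sum_congr rfl fun u _ => ?_
    rw [← add_mul, ← mul_add, c2qHom_qd_add]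
  simp only [Finset.sum_mul] at hcomm ⊢
  rw [Finset.sum_comm, Finset.sum_congr rfl fun s _ => hcomm s, Finset.sum_comm]

theorem tubeDFT_tConjT (A : Tensor Quat n₁ n₂ (N + 1)) (m : Fin (N + 1)) :
    tubeDFT (tConjT A) m = (tubeDFT A m)ᴴ := by
  ext1 i j
  simp only [tubeDFT, Matrix.of_apply, tConjT_apply, Matrix.conjTranspose_apply, star_sum,
    mul_sub, Finset.sum_sub_distrib, star_mul, star_c2qHom]
  rw [← Equiv.sum_comp (Equiv.neg (Fin (N + 1))), ← Finset.sum_sub_distrib]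
  refine Finset.sum_congr rfl fun t _ => ?_
  rw [Equiv.neg_apply, neg_neg, star_eq_c2qHom_sub, sub_mul, mul_assoc _ jH,
    ← star_star (charTable m t), ← c2qHom_mul_jH, star_star, star_charTable]
  simp only [← mul_assoc, ← map_mul]
  simp only [mul_comm]

theorem tubeDFT_idT (n : ℕ) (m : Fin (N + 1)) : tubeDFT (idT n (N + 1)) m = 1 := by
  ext1 i j
  rw [tubeDFT, Matrix.of_apply, Finset.sum_eq_single 0]
  · simp [idT, charTable_zero]
  · intro t _ ht
    have : (t : ℕ) ≠ 0 := fun h => ht (Fin.ext h)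
    simp [idT, this]
  · simp

theorem isUnitaryT_tubeInvDFT {n : ℕ} (U : Tensor Quat n n (N + 1))
    (hU : ∀ m, U m ∈ unitary (Matrix (Fin n) (Fin n) Quat)) : IsUnitaryT (tubeInvDFT U) := by
  constructor <;> refine tubeDFT_injective (funext fun m => ?_) <;>
    rw [tubeDFT_qtmul, tubeDFT_tConjT, tubeDFT_idT, tubeDFT_tubeInvDFT]
  · exact (Unitary.mem_iff.mp (hU m)).1
  · exact (Unitary.mem_iff.mp (hU m)).2

end QuaternionDFT

/-- QT-SVD: `A = U *_Q S *_Q V*` with `U, V` unitary tensors and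
`S` an f-diagonal tensor. -/
theorem stmt7 {n₁ n₂ n₃ : ℕ} (A : Tensor Quat n₁ n₂ n₃) :
    ∃ (U : Tensor Quat n₁ n₁ n₃) (V : Tensor Quat n₂ n₂ n₃) (S : Tensor Quat n₁ n₂ n₃),
      IsUnitaryT U ∧ IsUnitaryT V ∧
      (∀ (k : Fin n₃) (i : Fin n₁) (j : Fin n₂), (i : ℕ) ≠ (j : ℕ) → S k i j = 0) ∧
      A = qtmul (qtmul U S) (tConjT V) := by

  cases n₃ with
  | zero =>
    refine ⟨fun k => k.elim0, fun k => k.elim0, fun k => k.elim0, ⟨?_, ?_⟩, ⟨?_, ?_⟩,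
      fun k => k.elim0, ?_⟩ <;> exact funext fun k => k.elim0
  | succ N =>
    choose U hU V hV S hS hA using fun m => exists_quaternion_svd n₁ n₂ (tubeDFT A m)
    refine ⟨tubeInvDFT U, tubeInvDFT V, tubeInvDFT S, isUnitaryT_tubeInvDFT U hU,
      isUnitaryT_tubeInvDFT V hV, fun k i j hij => ?_, tubeDFT_injective (funext fun m => ?_)⟩
    · simp [tubeInvDFT, hS _ i j hij]
    · rw [tubeDFT_qtmul, tubeDFT_qtmul, tubeDFT_tConjT, tubeDFT_tubeInvDFT, tubeDFT_tubeInvDFT,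
        tubeDFT_tubeInvDFT]
      exact hA m

end
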